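/- Let x, y be units in a special local Moufang set such that x·α_y is also a unit. Then x μ_{xα_y} = (-y) α_{-x} α_{xμ_y} α_{-y}. -/

import Mathlib

open Equiv

structure LocalMoufangSet (X : Type*) where
  r : X → X → Prop
  requiv : Equivalence r
  U : X → Subgroup (Equiv.Perm X)
  preserves : ∀ x : X, ∀ u ∈ U x, ∀ a b : X, r a b ↔ r (u a) (u b)
  big : ∃ a b c : X, ¬ r a b ∧ ¬ r b c ∧ ¬ r a c
  lm1 : ∀ x y : X, r x y → ∀ u ∈ U x, ∃ v ∈ U y, ∀ z : X, r (u z) (v z)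
  lm2_fix : ∀ x : X, ∀ u ∈ U x, u x = x
  lm2_trans : ∀ x y z : X, ¬ r y x → ¬ r z x → ∃! u : Equiv.Perm X, u ∈ U x ∧ u y = z
  lm2'_trans : ∀ x y z : X, ¬ r y x → ¬ r z x → ∃ u ∈ U x, r (u y) z
  lm2'_free : ∀ x : X, ∀ u ∈ U x, ∀ y : X, ¬ r y x → r (u y) y → ∀ z : X, r (u z) z
  lm3 : ∀ x : X, ∀ g ∈ (⨆ y : X, U y : Subgroup (Equiv.Perm X)),
      (U x).map (MulAut.conj g).toMonoidHom = U (g x)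

namespace LocalMoufangSet

variable {X : Type*} (M : LocalMoufangSet X)

/-- The little projective group. -/
def G : Subgroup (Equiv.Perm X) := ⨆ x : X, M.U x

/-- `x` is a unit with respect to the base points `o` (zero) and `ι` (infinity). -/
def IsUnitPt (o ι x : X) : Prop := ¬ M.r x o ∧ ¬ M.r x ι

/-- `μ` is the μ-map of `x`: it lies in the double coset `U_0 α_x U_0` and swaps `o` and `ι`.
(We use the left-action convention: a right product `g α h` corresponds to `h * α * g`.) -/
def IsMuMap (o ι x : X) (μ : Equiv.Perm X) : Prop :=
  μ o = ι ∧ μ ι = o ∧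
    ∃ a ∈ M.U ι, a o = x ∧ ∃ g ∈ M.U o, ∃ h ∈ M.U o, μ = h * a * g

/-- Specialness with respect to a μ-map `τ`: `(-x)τ = -(xτ)` for all units `x`. -/
def Special (o ι : X) (τ : Equiv.Perm X) : Prop :=
  ∀ z : X, IsUnitPt M o ι z → ∀ a ∈ M.U ι, a o = z → ∀ b ∈ M.U ι, b o = τ z →
    τ (a⁻¹ o) = b⁻¹ o

end LocalMoufangSet

namespace LocalMoufangSet

variable {X : Type*} {M : LocalMoufangSet X} {o ι : X}

theorem U_le_G (p : X) : M.U p ≤ M.G := le_iSup M.U p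

theorem r_iff_of_mem_G {g : Equiv.Perm X} (hg : g ∈ M.G) (a b : X) :
    M.r a b ↔ M.r (g a) (g b) := by
  induction hg using Subgroup.iSup_induction' generalizing a b with
  | hp p u hu => exact M.preserves p u hu a b
  | h1 => rfl
  | hmul u v _ _ hu hv => rw [hv a b, hu (v a) (v b)]; rfl

theorem conj_mem {g : Equiv.Perm X} (hg : g ∈ M.G) {p : X} {u : Equiv.Perm X}
    (hu : u ∈ M.U p) : g * u * g⁻¹ ∈ M.U (g p) := by
  rw [← M.lm3 p g hg]
  exact ⟨u, hu, rfl⟩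

/-- The root group `U p` acts freely on the points not equivalent to `p`. -/
theorem eq_of_apply_eq {p q : X} (hq : ¬ M.r q p) {u v : Equiv.Perm X} (hu : u ∈ M.U p)
    (hv : v ∈ M.U p) (h : u q = v q) : u = v := by
  have hvq : ¬ M.r (v q) p := by
    have := (M.preserves p v hv q p).not.mp hq
    rwa [M.lm2_fix p v hv] at this
  exact (M.lm2_trans p q (v q) hq hvq).unique ⟨hu, h⟩ ⟨hv, rfl⟩

theorem IsMuMap.mem_G {x : X} {μ : Equiv.Perm X} (hμ : M.IsMuMap o ι x μ) : μ ∈ M.G := by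
  obtain ⟨-, -, a, ha, -, g, hg, h, hh, rfl⟩ := hμ
  exact mul_mem (mul_mem (U_le_G o hh) (U_le_G ι ha)) (U_le_G o hg)

theorem isUnitPt_apply {μ : Equiv.Perm X} (hμ : μ ∈ M.G) (ho : μ o = ι) (hι : μ ι = o) {x : X} :
    M.IsUnitPt o ι (μ x) ↔ M.IsUnitPt o ι x := by
  have h1 := r_iff_of_mem_G hμ x o
  have h2 := r_iff_of_mem_G hμ x ι
  rw [ho] at h1
  rw [hι] at h2
  simp only [IsUnitPt, h1, h2, and_comm]

/-- Inversion in `U o` and in `U ι`, transported to unit points, agree. This is specialness stated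
without reference to a μ-map. -/
def InvAgree (M : LocalMoufangSet X) (o ι : X) : Prop :=
  ∀ g ∈ M.U o, ∀ a ∈ M.U ι, g ι = a o → M.IsUnitPt o ι (a o) → g⁻¹ ι = a⁻¹ o

theorem Special.invAgree {τ : Equiv.Perm X} (hτ : τ ∈ M.G) (ho : τ o = ι) (hι : τ ι = o)
    (hsp : M.Special o ι τ) : M.InvAgree o ι := by
  intro g hg a ha hga hu
  have ho' : τ⁻¹ ι = o := by rw [← ho]; simp
  have hι' : τ⁻¹ o = ι := by rw [← hι]; simp
  have hc : τ⁻¹ * g * τ ∈ M.U ι := by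
    simpa [hι'] using conj_mem (inv_mem hτ) hg
  have hco : (τ⁻¹ * g * τ) o = τ⁻¹ (a o) := by simp [ho, hga]
  have hu' : M.IsUnitPt o ι (τ⁻¹ (a o)) := by
    rw [← isUnitPt_apply hτ ho hι]; simpa using hu
  have := hsp _ hu' _ hc hco a ha (by simp)
  simpa [mul_assoc, ho] using this

theorem InvAgree.special (hM : M.InvAgree o ι) {μ : Equiv.Perm X} (hμ : μ ∈ M.G)
    (ho : μ o = ι) (hι : μ ι = o) : M.Special o ι μ := by
  intro z hz c hc hcz a ha haz
  have ho' : μ⁻¹ ι = o := by rw [← ho]; simp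
  have hg : μ * c * μ⁻¹ ∈ M.U o := by simpa [hι] using conj_mem hμ hc
  have h := hM _ hg a ha (by simp only [Perm.mul_apply, ho', hcz, haz])
    (by rw [haz]; exact (isUnitPt_apply hμ ho hι).2 hz)
  simpa only [mul_inv_rev, inv_inv, Perm.mul_apply, ho'] using h

/-- In a special local Moufang set, `μ_x` equals both `g α_x g` and `α_x g α_x`, where `g ∈ U o`
sends `ι` to `-x`. -/
theorem InvAgree.isMuMap_eq (hM : M.InvAgree o ι) (h0 : ¬ M.r o ι) {x : X}
    (hx : M.IsUnitPt o ι x) {μ : Equiv.Perm X} (hμ : M.IsMuMap o ι x μ) {a : Equiv.Perm X}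
    (ha : a ∈ M.U ι) (hax : a o = x) :
    ∃ g ∈ M.U o, g ι = a⁻¹ o ∧ g⁻¹ ι = x ∧ μ = a * g * a := by
  have hμG := hμ.mem_G
  obtain ⟨ho, hι, a', ha', hax', g, hg, h, hh, hμe⟩ := hμ
  obtain rfl : a' = a := eq_of_apply_eq h0 ha' ha (hax'.trans hax.symm)
  have hι0 : ¬ M.r ι o := fun h => h0 (M.requiv.symm h)
  have hhx : h x = ι := by simpa [hμe, M.lm2_fix o g hg, hax] using ho
  have hgι : g ι = a'⁻¹ o := by
    have h1 : h (a' (g ι)) = h o := by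
      rw [M.lm2_fix o h hh]; simpa [hμe] using hι
    rw [← h.injective h1]; simp
  have hhι : h ι = a'⁻¹ o := by
    have := hM h⁻¹ (inv_mem hh) a' ha' (by rw [hax, ← hhx]; simp) (by rwa [hax])
    simpa using this
  obtain rfl : h = g := eq_of_apply_eq hι0 hh hg (hhι.trans hgι.symm)
  have hμx : μ x = a'⁻¹ o := by simp [hμe, hhx, M.lm2_fix ι a' ha', hgι]
  have hμn : μ (a'⁻¹ o) = x := by
    rw [hM.special hμG ho hι x hx a' ha' hax a'⁻¹ (inv_mem ha') hμx.symm, inv_inv, hax]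
  have ho' : μ⁻¹ ι = o := by rw [← ho]; simp
  have hι' : μ⁻¹ o = ι := by rw [← hι]; simp
  have e1 : μ * h * μ⁻¹ = a' :=
    eq_of_apply_eq h0 (by simpa [ho] using conj_mem hμG hh) ha' (by
      simp only [Perm.mul_apply, hι', hgι, hμn, hax])
  have e2 : μ * a' * μ⁻¹ = h :=
    eq_of_apply_eq hι0 (by simpa [hι] using conj_mem hμG ha') hh (by
      simp only [Perm.mul_apply, ho', hax, hμx, hgι])
  refine ⟨h, hh, hgι, by rw [← hhx]; simp, ?_⟩
  calc μ = μ * (h * a' * h) * μ⁻¹ := by rw [← hμe]; simp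
    _ = (μ * h * μ⁻¹) * (μ * a' * μ⁻¹) * (μ * h * μ⁻¹) := by group
    _ = a' * h * a' := by rw [e1, e2]

end LocalMoufangSet

open LocalMoufangSet

/-- `x μ_{xα_y} = (-y) α_{-x} α_{xμ_y} α_{-y}` in a special local
Moufang set.  Left-action convention: `x·α_y = αy x`, `-y = αy⁻¹ o`,
`α_{-x} = α⁻¹`, `α_{-y} = αy⁻¹`, and `b` is the α-map of `xμ_y = μy x`, so the
right-hand side is `(αy⁻¹ * b * α⁻¹) (αy⁻¹ o)`. -/
theorem stmt16 {X : Type*} (M : LocalMoufangSet X) (o ι : X) (h0 : ¬ M.r o ι)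
    (e : X) (he : M.IsUnitPt o ι e)
    (τ : Equiv.Perm X) (hτ : M.IsMuMap o ι e τ)
    (hsp : M.Special o ι τ)
    (x : X) (hx : M.IsUnitPt o ι x)
    (α : Equiv.Perm X) (hαU : α ∈ M.U ι) (hαo : α o = x)
    (y : X) (hy : M.IsUnitPt o ι y)
    (αy : Equiv.Perm X) (hαyU : αy ∈ M.U ι) (hαyo : αy o = y)
    (hxy : M.IsUnitPt o ι (αy x))
    (μ' μy : Equiv.Perm X)
    (hμ' : M.IsMuMap o ι (αy x) μ') (hμy : M.IsMuMap o ι y μy)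
    (b : Equiv.Perm X) (hbU : b ∈ M.U ι) (hb : b o = μy x) :
    μ' x = (αy⁻¹ * b * α⁻¹) (αy⁻¹ o) := by
  have hM := hsp.invAgree hτ.mem_G hτ.1 hτ.2.1
  have haU : αy * α ∈ M.U ι := mul_mem hαyU hαU
  have hao : (αy * α) o = αy x := by simp [hαo]
  have hoιy : αy ι = ι := M.lm2_fix ι αy hαyU
  obtain ⟨g, hg, -, hgz, hμ'e⟩ := hM.isMuMap_eq h0 hxy hμ' haU hao
  obtain ⟨k, hk, -, hky, hμye⟩ := hM.isMuMap_eq h0 hy hμy hαyU hαyo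
  have hdU : αy⁻¹ * b ∈ M.U ι := mul_mem (inv_mem hαyU) hbU
  have hdo : (αy⁻¹ * b) o = k (αy x) := by simp [hb, hμye]
  have hw : M.IsUnitPt o ι (k (αy x)) := by
    constructor
    · have := (M.preserves o k hk (αy x) o).not.mp hxy.1
      rwa [M.lm2_fix o k hk] at this
    · have h1 : ¬ M.r (μy x) ι := ((isUnitPt_apply hμy.mem_G hμy.1 hμy.2.1).2 hx).2
      rw [M.preserves ι αy hαyU, hoιy]
      simpa [hμye] using h1
  have hgy : g y = (αy⁻¹ * b)⁻¹ o := by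
    rw [← hM (k * g⁻¹) (mul_mem hk (inv_mem hg)) _ hdU (by rw [hdo, Perm.mul_apply, hgz])
      (by rwa [hdo]), mul_inv_rev, inv_inv, Perm.mul_apply, hky]
  have hux : M.IsUnitPt o ι (μ' x) := (isUnitPt_apply hμ'.mem_G hμ'.1 hμ'.2.1).2 hx
  obtain ⟨B, ⟨hBU, hBo⟩, -⟩ := M.lm2_trans ι o (μ' x) h0 hux.2
  have hneg : B⁻¹ o = (αy * α * (αy⁻¹ * b)⁻¹) o := by
    rw [← hM.special hμ'.mem_G hμ'.1 hμ'.2.1 x hx α hαU hαo B hBU hBo, Perm.mul_apply,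
      ← hgy, hμ'e]
    simp [hαyo]
  have hB : B⁻¹ = αy * α * (αy⁻¹ * b)⁻¹ :=
    eq_of_apply_eq h0 (inv_mem hBU) (mul_mem haU (inv_mem hdU)) hneg
  rw [← hBo, inv_eq_iff_eq_inv.mp hB]
  simp [mul_assoc]
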